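/- There is a universal constant C > 0 with the following property (VC inequality for the A_k-norm). Let f be a probability density function on an interval I ⊆ ℝ, let k and n be positive integers, let X_1, …, X_n be drawn i.i.d. from the distribution with density f, and let μ_n := (1/n) Σ_{i=1}^n δ_{X_i} be the empirical distribution. Then E[ ‖μ_n − f‖_{A_k} ] ≤ C · √(k/n). -/

import Mathlib

open MeasureTheory Set

/-- The `A_k`-distance between a function `g` and a Borel measure `μ` on a subinterval `J`:
the supremum over all collections of `k` pairwise disjoint subintervals `I₁, …, I_k` of `J`
of `∑ᵢ |μ(Iᵢ) − ∫_{Iᵢ} g|`. -/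
noncomputable def akDist (k : ℕ) (J : Set ℝ) (g : ℝ → ℝ) (μ : Measure ℝ) : ℝ :=
  sSup { s : ℝ | ∃ I : Fin k → Set ℝ,
    (∀ i, I i ⊆ J ∧ (I i).OrdConnected) ∧
    (Pairwise fun i j => Disjoint (I i) (I j)) ∧
    s = ∑ i, |(μ (I i)).toReal - ∫ x in I i, g x| }

/-- `f` is a probability density function on `I`. -/
def IsPDFOn (f : ℝ → ℝ) (I : Set ℝ) : Prop :=
  (∀ x ∈ I, 0 ≤ f x) ∧ IntegrableOn f I ∧ (∫ x in I, f x) = 1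

/-- The measure on `ℝ` with density `f` on `I`. -/
noncomputable def densityMeasure (I : Set ℝ) (f : ℝ → ℝ) : Measure ℝ :=
  (volume.restrict I).withDensity fun x => ENNReal.ofReal (f x)

/-- The empirical distribution `μ_n = (1/n) ∑ᵢ δ_{Xᵢ}` of the sample vector `X`. -/
noncomputable def empMeasure (n : ℕ) (X : Fin n → ℝ) : Measure ℝ :=
  ∑ i, ((n : ENNReal))⁻¹ • Measure.dirac (X i)


/-- Moment bounds for a sum of independent centred random variables with values in `[-1, 1]`. -/
lemma moments_sum_of_iIndepFun {Ω ι : Type*} [MeasurableSpace Ω] {μ : Measure Ω}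
    [IsProbabilityMeasure μ] {Y : ι → Ω → ℝ} {v : ℝ}
    (hind : ProbabilityTheory.iIndepFun Y μ) (hmeas : ∀ i, Measurable (Y i))
    (hbound : ∀ i ω, |Y i ω| ≤ 1) (hmean : ∀ i, ∫ ω, Y i ω ∂μ = 0)
    (hvar : ∀ i, ∫ ω, Y i ω ^ 2 ∂μ ≤ v) (s : Finset ι) :
    ∫ ω, ∑ i ∈ s, Y i ω ∂μ = 0 ∧
      ∫ ω, (∑ i ∈ s, Y i ω) ^ 2 ∂μ ≤ s.card * v ∧
      ∫ ω, (∑ i ∈ s, Y i ω) ^ 4 ∂μ ≤ 3 * (s.card : ℝ) ^ 2 * v ^ 2 + s.card * v := by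
  classical
  induction s using Finset.induction_on with
  | empty => simp
  | insert a s ha ih =>
    obtain ⟨ih1, ih2, ih4⟩ := ih
    set S : Ω → ℝ := fun ω => ∑ i ∈ s, Y i ω with hS
    have hSm : Measurable S := Finset.measurable_sum s fun i _ => hmeas i
    have hSb : ∀ ω, |S ω| ≤ s.card := fun ω =>
      (Finset.abs_sum_le_sum_abs _ _).trans <| by
        simpa using Finset.sum_le_sum fun i (_ : i ∈ s) => hbound i ω
    have hint : ∀ p q : ℕ, Integrable (fun ω => S ω ^ p * Y a ω ^ q) μ := fun p q => by
      refine Integrable.of_bound ((hSm.pow_const p).mul ((hmeas a).pow_const q)).aestronglyMeasurable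
        ((s.card : ℝ) ^ p * 1 ^ q) (Filter.Eventually.of_forall fun ω => ?_)
      rw [Real.norm_eq_abs, abs_mul, abs_pow, abs_pow]
      gcongr
      · exact hSb ω
      · exact hbound a ω
    have hSY : ProbabilityTheory.IndepFun S (Y a) μ := by
      have h := hind.indepFun_finsetSum_of_notMem hmeas ha
      convert h using 1
      ext ω
      simp [hS]
    have hprod : ∀ p q : ℕ, ∫ ω, S ω ^ p * Y a ω ^ q ∂μ
        = (∫ ω, S ω ^ p ∂μ) * ∫ ω, Y a ω ^ q ∂μ := fun p q =>
      (hSY.comp (φ := fun x => x ^ p) (ψ := fun x => x ^ q) (by fun_prop)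
        (by fun_prop)).integral_fun_mul_eq_mul_integral
        (hSm.pow_const p).aestronglyMeasurable ((hmeas a).pow_const q).aestronglyMeasurable
    have h4le : ∫ ω, Y a ω ^ 4 ∂μ ≤ v := by
      refine le_trans (integral_mono (by simpa using hint 0 4) (by simpa using hint 0 2)
        fun ω => ?_) (hvar a)
      have h1 : Y a ω ^ 2 ≤ 1 := by
        rw [← sq_abs]; exact pow_le_one₀ (abs_nonneg _) (hbound a ω)
      have h2 := sq_nonneg (Y a ω)
      change Y a ω ^ 4 ≤ Y a ω ^ 2
      nlinarith
    have hv : 0 ≤ v := le_trans (integral_nonneg fun ω => sq_nonneg _) (hvar a)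
    have h2nn : 0 ≤ ∫ ω, Y a ω ^ 2 ∂μ := integral_nonneg fun ω => sq_nonneg _
    have e1 : ∫ ω, ∑ i ∈ insert a s, Y i ω ∂μ = 0 := by
      rw [integral_finsetSum _ fun i _ => ?_]
      · simp [hmean]
      · exact Integrable.of_bound (hmeas i).aestronglyMeasurable 1
          (Filter.Eventually.of_forall fun ω => hbound i ω)
    have e2 : ∫ ω, (∑ i ∈ insert a s, Y i ω) ^ 2 ∂μ
        = ∫ ω, S ω ^ 2 ∂μ + ∫ ω, Y a ω ^ 2 ∂μ := by
      have : (fun ω => (∑ i ∈ insert a s, Y i ω) ^ 2)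
          = fun ω => S ω ^ 2 * Y a ω ^ 0 + 2 * (S ω ^ 1 * Y a ω ^ 1) + S ω ^ 0 * Y a ω ^ 2 := by
        ext ω; rw [Finset.sum_insert ha]; simp only [hS]; ring
      rw [this, integral_add ((hint 2 0).fun_add ((hint 1 1).const_mul 2)) (hint 0 2),
        integral_add (hint 2 0) ((hint 1 1).const_mul 2), integral_const_mul, hprod 1 1]
      simp [hmean]
    have e4 : ∫ ω, (∑ i ∈ insert a s, Y i ω) ^ 4 ∂μ
        = ∫ ω, S ω ^ 4 ∂μ + 6 * ((∫ ω, S ω ^ 2 ∂μ) * ∫ ω, Y a ω ^ 2 ∂μ)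
          + ∫ ω, Y a ω ^ 4 ∂μ := by
      have : (fun ω => (∑ i ∈ insert a s, Y i ω) ^ 4)
          = fun ω => S ω ^ 4 * Y a ω ^ 0 + 4 * (S ω ^ 3 * Y a ω ^ 1) + 6 * (S ω ^ 2 * Y a ω ^ 2)
            + 4 * (S ω ^ 1 * Y a ω ^ 3) + S ω ^ 0 * Y a ω ^ 4 := by
        ext ω; rw [Finset.sum_insert ha]; simp only [hS]; ring
      have i1 := (hint 4 0).fun_add ((hint 3 1).const_mul 4)
      have i2 := i1.fun_add ((hint 2 2).const_mul 6)
      have i3 := i2.fun_add ((hint 1 3).const_mul 4)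
      rw [this, integral_add i3 (hint 0 4), integral_add i2 ((hint 1 3).const_mul 4),
        integral_add i1 ((hint 2 2).const_mul 6), integral_add (hint 4 0) ((hint 3 1).const_mul 4)]
      simp only [integral_const_mul]
      rw [hprod 3 1, hprod 2 2, hprod 1 3]
      simp only [pow_one, pow_zero, mul_one, one_mul, hmean]
      rw [show ∫ ω, S ω ∂μ = 0 from ih1]
      ring
    refine ⟨e1, ?_, ?_⟩
    · rw [e2, Finset.card_insert_of_notMem ha]
      push_cast
      linarith [hvar a, show ∫ ω, S ω ^ 2 ∂μ ≤ s.card * v from ih2]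
    · rw [e4, Finset.card_insert_of_notMem ha]
      push_cast
      have hm : (∫ ω, S ω ^ 2 ∂μ) * ∫ ω, Y a ω ^ 2 ∂μ ≤ (s.card * v) * v :=
        mul_le_mul ih2 (hvar a) h2nn (by positivity)
      have h4 : ∫ ω, S ω ^ 4 ∂μ ≤ 3 * (s.card : ℝ) ^ 2 * v ^ 2 + s.card * v := ih4
      nlinarith [sq_nonneg v]

/-- The distribution function of an atomless law is uniform: the event that it takes values
in `[a, b]` has probability at most `b - a`. -/
lemma measureReal_cdf_preimage_Icc_le {P : Measure ℝ} [IsProbabilityMeasure P]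
    (hP : ∀ x, P {x} = 0) {a b : ℝ} (hab : a ≤ b) :
    P.real {x | P.real (Iic x) ∈ Icc a b} ≤ b - a := by
  have hmono : Monotone fun x => P.real (Iic x) := fun x y h =>
    measureReal_mono (Iic_subset_Iic.2 h)
  have hms : MeasurableSet {x | P.real (Iic x) ∈ Icc a b} := hmono.measurable measurableSet_Icc
  refine (ENNReal.toReal_le_of_le_ofReal (sub_nonneg.2 hab) (le_of_forall_lt fun r hr => ?_))
  obtain ⟨K, hKs, hK, hrK⟩ := hms.exists_lt_isCompact hr
  refine hrK.trans_le ?_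
  rcases K.eq_empty_or_nonempty with rfl | hne
  · simp
  have h1 := hKs (hK.sInf_mem hne)
  have h2 := hKs (hK.sSup_mem hne)
  simp only [mem_ofPred_eq, mem_Icc] at h1 h2
  have hle : sInf K ≤ sSup K := csInf_le hK.bddBelow (hK.sSup_mem hne)
  have hKI : K ⊆ {sInf K} ∪ (Iic (sSup K) \ Iic (sInf K)) := fun x hx => by
    rcases (csInf_le hK.bddBelow hx).eq_or_lt with h | h
    · exact Or.inl h.symm
    · exact Or.inr ⟨le_csSup hK.bddAbove hx, not_le.2 h⟩
  calc P K ≤ P {sInf K} + P (Iic (sSup K) \ Iic (sInf K)) :=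
        (measure_mono hKI).trans (measure_union_le _ _)
    _ = ENNReal.ofReal (P.real (Iic (sSup K) \ Iic (sInf K))) := by
        rw [hP, zero_add, ofReal_measureReal]
    _ ≤ ENNReal.ofReal (b - a) := by
        rw [measureReal_sdiff (Iic_subset_Iic.2 hle) measurableSet_Iic]
        exact ENNReal.ofReal_le_ofReal (by linarith)

/-- The union of the fibres of `κ` that are contained in `A`. -/
def fiberCore (κ : ℝ → ℕ) (A : Set ℝ) : Set ℝ := {x | ∀ y, κ y = κ x → y ∈ A}

lemma fiberCore_subset (κ : ℝ → ℕ) (A : Set ℝ) : fiberCore κ A ⊆ A := fun x hx => hx x rfl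

lemma measurableSet_fiberCore {κ : ℝ → ℕ} (hκ : Measurable κ) (A : Set ℝ) :
    MeasurableSet (fiberCore κ A) :=
  hκ (MeasurableSet.of_discrete (s := {q | ∀ y, κ y = q → y ∈ A}))

open Classical in
/-- The values at most `m` that `κ` takes on `A`. -/
noncomputable def fiberIndices (κ : ℝ → ℕ) (m : ℕ) (A : Set ℝ) : Finset ℕ :=
  {q ∈ Finset.range (m + 1) | ∃ x ∈ A, κ x = q}

lemma mem_fiberIndices {κ : ℝ → ℕ} {m : ℕ} {A : Set ℝ} {q : ℕ} :
    q ∈ fiberIndices κ m A ↔ q ∈ Finset.range (m + 1) ∧ ∃ x ∈ A, κ x = q := by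
  simp [fiberIndices]

lemma fiberIndices_subset (κ : ℝ → ℕ) (m : ℕ) (A : Set ℝ) :
    fiberIndices κ m A ⊆ Finset.range (m + 1) := fun _ hq => (mem_fiberIndices.1 hq).1

lemma card_fiberIndices_le_two {κ : ℝ → ℕ} (m : ℕ) {A : Set ℝ}
    (h : ∀ x ∈ A, ∀ y ∈ A, ∀ z ∈ A, κ x < κ y → ¬ κ y < κ z) :
    (fiberIndices κ m A).card ≤ 2 := by
  by_contra! hc
  obtain ⟨a, b, c, ha, hb, hc, hab, hac, hbc⟩ := Finset.two_lt_card_iff.1 hc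
  obtain ⟨-, x, hx, rfl⟩ := mem_fiberIndices.1 ha
  obtain ⟨-, y, hy, rfl⟩ := mem_fiberIndices.1 hb
  obtain ⟨-, z, hz, rfl⟩ := mem_fiberIndices.1 hc
  have h1 := h x hx y hy z hz
  have h2 := h x hx z hz y hy
  have h3 := h y hy x hx z hz
  have h4 := h y hy z hz x hx
  have h5 := h z hz x hx y hy
  have h6 := h z hz y hy x hx
  omega

/-- An interval meets at most two fibres of a monotone map without containing them. -/
lemma card_fiberIndices_diff_fiberCore_le {κ : ℝ → ℕ} (hκ : Monotone κ) (m : ℕ) {A : Set ℝ}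
    (hA : A.OrdConnected) : (fiberIndices κ m (A \ fiberCore κ A)).card ≤ 2 := by
  refine card_fiberIndices_le_two m fun x hx y hy z hz hxy hyz => hy.2 fun w hw => ?_
  exact hA.out hx.1 hz.1 ⟨(hκ.reflect_lt (hw ▸ hxy)).le, (hκ.reflect_lt (hw ▸ hyz)).le⟩

/-- When each fibre is halved, the core of an interval grows by at most two fibres. -/
lemma card_fiberIndices_fiberCore_diff_le {κ κ' : ℝ → ℕ} (hκ' : Monotone κ')
    (hdiv : ∀ x, κ x = κ' x / 2) (m : ℕ) {A : Set ℝ} (hA : A.OrdConnected) :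
    (fiberIndices κ' m (fiberCore κ' A \ fiberCore κ A)).card ≤ 2 := by
  refine card_fiberIndices_le_two m fun x hx y hy z hz hxy hyz => hy.2 fun w hw => ?_
  rw [hdiv, hdiv] at hw
  rcases eq_or_ne (κ' w) (κ' x) with h | hwx
  · exact hx.1 w h
  rcases eq_or_ne (κ' w) (κ' z) with h | hwz
  · exact hz.1 w h
  exact hA.out (fiberCore_subset _ _ hx.1) (fiberCore_subset _ _ hz.1)
    ⟨(hκ'.reflect_lt (by omega)).le, (hκ'.reflect_lt (by omega)).le⟩

lemma fiberCore_mono {κ κ' : ℝ → ℕ} (hdiv : ∀ x, κ x = κ' x / 2) (A : Set ℝ) :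
    fiberCore κ A ⊆ fiberCore κ' A := fun x hx y hy => hx y (by rw [hdiv, hdiv, hy])

/-- Disjoint sets have disjoint cores, even at the level of fibres. -/
lemma disjoint_fiberIndices {κ : ℝ → ℕ} (m : ℕ) {A B A' B' : Set ℝ} (hAB : Disjoint A B)
    (hA' : A' ⊆ fiberCore κ A) (hB' : B' ⊆ fiberCore κ B) :
    Disjoint (fiberIndices κ m A') (fiberIndices κ m B') := by
  refine Finset.disjoint_left.2 fun q hq hq' => ?_
  obtain ⟨-, x, hx, hxq⟩ := mem_fiberIndices.1 hq
  obtain ⟨-, y, hy, hyq⟩ := mem_fiberIndices.1 hq'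
  exact disjoint_left.1 hAB (hA' hx y (hyq.trans hxq.symm)) (fiberCore_subset _ _ (hB' hy))

/-- The discrepancy of a union of fibres is at most the sum of the discrepancies of the fibres. -/
lemma abs_measureReal_sub_le_sum_fiberIndices (μ ν : Measure ℝ) [IsFiniteMeasure μ]
    [IsFiniteMeasure ν] {κ : ℝ → ℕ} (hκ : Measurable κ) {m : ℕ} (hm : ∀ x, κ x ≤ m) {A : Set ℝ}
    (hA : ∀ x ∈ A, ∀ y, κ y = κ x → y ∈ A) :
    |μ.real A - ν.real A| ≤
      ∑ q ∈ fiberIndices κ m A, |μ.real (κ ⁻¹' {q}) - ν.real (κ ⁻¹' {q})| := by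
  have hpre : A = κ ⁻¹' (fiberIndices κ m A : Set ℕ) := by
    ext x
    simp only [mem_preimage, Finset.mem_coe, mem_fiberIndices, Finset.mem_range]
    exact ⟨fun hx => ⟨Nat.lt_succ_of_le (hm x), x, hx, rfl⟩,
      fun ⟨_, y, hy, hyx⟩ => hA y hy x hyx.symm⟩
  have hf : ∀ q ∈ fiberIndices κ m A, MeasurableSet (κ ⁻¹' {q}) := fun q _ =>
    hκ (measurableSet_singleton q)
  conv_lhs => rw [hpre]
  rw [← sum_measureReal_preimage_singleton _ hf, ← sum_measureReal_preimage_singleton _ hf,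
    ← Finset.sum_sub_distrib]
  exact Finset.abs_sum_le_sum_abs _ _

lemma abs_le_add_pow_four_div (d : ℝ) {τ : ℝ} (hτ : 0 < τ) : |d| ≤ τ + d ^ 4 / τ ^ 3 := by
  rcases le_total |d| τ with h | h
  · exact h.trans (le_add_of_nonneg_right (by positivity))
  · refine le_trans ?_ (le_add_of_nonneg_left hτ.le)
    rw [le_div_iff₀ (by positivity), ← Even.pow_abs (by decide : Even 4) d, pow_succ' |d| 3]
    gcongr

lemma sum_abs_le_card_mul_add {S R : Finset ℕ} (hSR : S ⊆ R) (d : ℕ → ℝ) {τ c : ℝ} (hτ : 0 < τ)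
    (hc : (S.card : ℝ) ≤ c) :
    ∑ q ∈ S, |d q| ≤ c * τ + (∑ q ∈ R, d q ^ 4) / τ ^ 3 := by
  calc ∑ q ∈ S, |d q| ≤ ∑ q ∈ S, (τ + d q ^ 4 / τ ^ 3) :=
        Finset.sum_le_sum fun q _ => abs_le_add_pow_four_div _ hτ
    _ = S.card * τ + ∑ q ∈ S, d q ^ 4 / τ ^ 3 := by
        rw [Finset.sum_add_distrib, Finset.sum_const, nsmul_eq_mul]
    _ ≤ c * τ + ∑ q ∈ R, d q ^ 4 / τ ^ 3 := by
        gcongr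
    _ = c * τ + (∑ q ∈ R, d q ^ 4) / τ ^ 3 := by rw [Finset.sum_div]

/-- Chaining bound for one family of unions of fibres with disjoint sets of indices. -/
lemma sum_abs_measureReal_sub_le_of_disjoint {k : ℕ} (μ ν : Measure ℝ) [IsFiniteMeasure μ]
    [IsFiniteMeasure ν] {κ : ℝ → ℕ} (hκ : Measurable κ) {m : ℕ} (hm : ∀ x, κ x ≤ m)
    {A : Fin k → Set ℝ} (hA : ∀ i, ∀ x ∈ A i, ∀ y, κ y = κ x → y ∈ A i)
    (hdisj : Pairwise fun i j => Disjoint (fiberIndices κ m (A i)) (fiberIndices κ m (A j)))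
    {τ : ℝ} (hτ : 0 < τ)
    (hcard : m + 1 ≤ 2 * k ∨ ∀ i, (fiberIndices κ m (A i)).card ≤ 2) :
    ∑ i, |μ.real (A i) - ν.real (A i)| ≤ 2 * k * τ +
      (∑ q ∈ Finset.range (m + 1), (μ.real (κ ⁻¹' {q}) - ν.real (κ ⁻¹' {q})) ^ 4) / τ ^ 3 := by
  classical
  refine (Finset.sum_le_sum fun i _ =>
    abs_measureReal_sub_le_sum_fiberIndices μ ν hκ hm (hA i)).trans ?_
  rw [← Finset.sum_biUnion fun i _ j _ hij => hdisj hij]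
  have hsub : Finset.univ.biUnion (fun i => fiberIndices κ m (A i)) ⊆ Finset.range (m + 1) :=
    Finset.biUnion_subset.2 fun i _ => fiberIndices_subset _ _ _
  refine sum_abs_le_card_mul_add hsub _ hτ ?_
  have : (Finset.univ.biUnion fun i => fiberIndices κ m (A i)).card ≤ 2 * k := by
    rcases hcard with h | h
    · exact (Finset.card_le_card hsub).trans (by simpa using h)
    · refine Finset.card_biUnion_le.trans ((Finset.sum_le_sum fun i _ => h i).trans ?_)
      simp [mul_comm]
  exact_mod_cast this

/-- Chaining bound for the parts of disjoint intervals outside of their cores. -/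
lemma sum_abs_measureReal_sub_diff_fiberCore_le {k : ℕ} (μ ν : Measure ℝ) [IsFiniteMeasure μ]
    [IsFiniteMeasure ν] {κ : ℝ → ℕ} (hκ : Monotone κ) {m : ℕ} (hm : ∀ x, κ x ≤ m)
    {I : Fin k → Set ℝ} (hI : ∀ i, (I i).OrdConnected)
    (hdisj : Pairwise fun i j => Disjoint (I i) (I j)) {τ δ : ℝ} (hτ : 0 < τ)
    (hδ : ∀ q, ν.real (κ ⁻¹' {q}) ≤ δ) :
    ∑ i, |μ.real (I i \ fiberCore κ (I i)) - ν.real (I i \ fiberCore κ (I i))| ≤ 2 * k * τ +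
      (∑ q ∈ Finset.range (m + 1), (μ.real (κ ⁻¹' {q}) - ν.real (κ ⁻¹' {q})) ^ 4) / τ ^ 3
      + 4 * k * δ := by
  classical
  have hδ0 : 0 ≤ δ := measureReal_nonneg.trans (hδ 0)
  set R : Fin k → Set ℝ := fun i => I i \ fiberCore κ (I i) with hR
  have hRm : ∀ i, MeasurableSet (R i) := fun i =>
    (hI i).measurableSet.diff (measurableSet_fiberCore hκ.measurable _)
  have hRd : Pairwise (Function.onFun Disjoint R) := fun i j hij =>
    (hdisj hij).mono sdiff_subset sdiff_subset
  set E : Finset ℕ := Finset.univ.biUnion fun i => fiberIndices κ m (R i) with hE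
  have hEcard : (E.card : ℝ) ≤ 2 * k := by
    have : E.card ≤ 2 * k := by
      refine Finset.card_biUnion_le.trans ((Finset.sum_le_sum fun i _ =>
        card_fiberIndices_diff_fiberCore_le hκ m (hI i)).trans ?_)
      simp [mul_comm]
    exact_mod_cast this
  have hEsub : E ⊆ Finset.range (m + 1) :=
    Finset.biUnion_subset.2 fun i _ => fiberIndices_subset _ _ _
  have hcover : (⋃ i, R i) ⊆ ⋃ q ∈ E, κ ⁻¹' {q} := by
    refine iUnion_subset fun i x hx => mem_iUnion₂.2 ⟨κ x, ?_, rfl⟩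
    exact Finset.mem_biUnion.2 ⟨i, Finset.mem_univ i, mem_fiberIndices.2
      ⟨Finset.mem_range.2 (Nat.lt_succ_of_le (hm x)), x, hx, rfl⟩⟩
  have hmass : ∀ ρ : Measure ℝ, IsFiniteMeasure ρ →
      ∑ i, ρ.real (R i) ≤ ∑ q ∈ E, ρ.real (κ ⁻¹' {q}) := fun ρ _ => by
    rw [← measureReal_iUnion_fintype hRd hRm]
    refine (measureReal_mono hcover ?_).trans (measureReal_biUnion_finset_le _ _)
    exact measure_ne_top _ _
  calc ∑ i, |μ.real (R i) - ν.real (R i)| ≤ ∑ i, (μ.real (R i) + ν.real (R i)) :=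
        Finset.sum_le_sum fun i _ => by
          rw [abs_le]
          constructor <;>
            linarith [measureReal_nonneg (μ := μ) (s := R i), measureReal_nonneg (μ := ν) (s := R i)]
    _ ≤ ∑ q ∈ E, (μ.real (κ ⁻¹' {q}) + ν.real (κ ⁻¹' {q})) := by
        rw [Finset.sum_add_distrib, Finset.sum_add_distrib]
        exact add_le_add (hmass μ inferInstance) (hmass ν inferInstance)
    _ ≤ ∑ q ∈ E, (|μ.real (κ ⁻¹' {q}) - ν.real (κ ⁻¹' {q})| + 2 * δ) :=
        Finset.sum_le_sum fun q _ => by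
          linarith [le_abs_self (μ.real (κ ⁻¹' {q}) - ν.real (κ ⁻¹' {q})), hδ q]
    _ = ∑ q ∈ E, |μ.real (κ ⁻¹' {q}) - ν.real (κ ⁻¹' {q})| + E.card * (2 * δ) := by
        rw [Finset.sum_add_distrib, Finset.sum_const, nsmul_eq_mul]
    _ ≤ _ := by
        have h1 := sum_abs_le_card_mul_add hEsub
          (fun q => μ.real (κ ⁻¹' {q}) - ν.real (κ ⁻¹' {q})) hτ hEcard
        have h2 : E.card * (2 * δ) ≤ 2 * k * (2 * δ) := by gcongr
        linarith

/-- Chaining bound for the total discrepancy of two measures on `k` disjoint intervals, along a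
sequence of nested partitions of the line into the fibres of the maps `κ j`. -/
lemma sum_abs_measureReal_sub_le {k : ℕ} (μ ν : Measure ℝ) [IsFiniteMeasure μ]
    [IsFiniteMeasure ν] {κ : ℕ → ℝ → ℕ} (hκ : ∀ j, Monotone (κ j)) {N : ℕ → ℕ}
    (hN : ∀ j x, κ j x ≤ N j) (hdiv : ∀ j x, κ j x = κ (j + 1) x / 2) (hN0 : N 0 + 1 ≤ 2 * k)
    {I : Fin k → Set ℝ} (hI : ∀ i, (I i).OrdConnected)
    (hdisj : Pairwise fun i j => Disjoint (I i) (I j)) {τ : ℕ → ℝ} (hτ : ∀ j, 0 < τ j)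
    {δ : ℝ} (J : ℕ) (hδ : ∀ q, ν.real (κ J ⁻¹' {q}) ≤ δ) :
    ∑ i, |μ.real (I i) - ν.real (I i)| ≤
      2 * ∑ j ∈ Finset.range (J + 1), (2 * k * τ j + (∑ q ∈ Finset.range (N j + 1),
        (μ.real (κ j ⁻¹' {q}) - ν.real (κ j ⁻¹' {q})) ^ 4) / τ j ^ 3) + 4 * k * δ := by
  set B : ℕ → ℝ := fun j => 2 * k * τ j + (∑ q ∈ Finset.range (N j + 1),
    (μ.real (κ j ⁻¹' {q}) - ν.real (κ j ⁻¹' {q})) ^ 4) / τ j ^ 3 with hB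
  have hB0 : ∀ j, 0 ≤ B j := fun j => by
    have := hτ j
    have h : 0 ≤ ∑ q ∈ Finset.range (N j + 1),
      (μ.real (κ j ⁻¹' {q}) - ν.real (κ j ⁻¹' {q})) ^ 4 :=
        Finset.sum_nonneg fun q _ => by positivity
    positivity
  set D : Set ℝ → ℝ := fun A => μ.real A - ν.real A with hD
  set U : ℕ → Fin k → Set ℝ := fun j i => fiberCore (κ j) (I i) with hU
  have hUm : ∀ j i, MeasurableSet (U j i) := fun j i =>
    measurableSet_fiberCore (hκ j).measurable _
  have hDdiff : ∀ {A A' : Set ℝ}, A ⊆ A' → MeasurableSet A → D (A' \ A) = D A' - D A :=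
    fun {A A'} h hA => by
      simp only [hD]
      rw [measureReal_sdiff h hA, measureReal_sdiff h hA]
      ring
  have hsplit : ∀ i, |D (I i)| ≤ |D (U 0 i)| + ∑ j ∈ Finset.range J, |D (U (j + 1) i \ U j i)|
      + |D (I i \ U J i)| := fun i => by
    have h1 : D (I i) = D (U 0 i) + ∑ j ∈ Finset.range J, D (U (j + 1) i \ U j i)
        + D (I i \ U J i) := by
      rw [Finset.sum_congr rfl fun j _ => hDdiff (fiberCore_mono (hdiv j) (I i)) (hUm j i),
        Finset.sum_range_sub (fun j => D (U j i)), hDdiff (fiberCore_subset _ _) (hUm J i)]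
      ring
    rw [h1]
    refine (abs_add_le _ _).trans (add_le_add ((abs_add_le _ _).trans (add_le_add le_rfl ?_)) le_rfl)
    exact Finset.abs_sum_le_sum_abs _ _
  have hzero : ∑ i, |D (U 0 i)| ≤ B 0 :=
    sum_abs_measureReal_sub_le_of_disjoint μ ν (A := U 0) (hκ 0).measurable (hN 0)
      (fun i x hx y hy z hz => hx z (hz.trans hy))
      (fun i j hij => disjoint_fiberIndices _ (hdisj hij) subset_rfl subset_rfl) (hτ 0)
      (Or.inl hN0)
  have hstep : ∀ j, ∑ i, |D (U (j + 1) i \ U j i)| ≤ B (j + 1) := fun j =>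
    sum_abs_measureReal_sub_le_of_disjoint μ ν (A := fun i => U (j + 1) i \ U j i)
      (hκ (j + 1)).measurable (hN (j + 1))
      (fun i x hx y hy => ⟨fun z hz => hx.1 z (hz.trans hy), fun h => hx.2 fun z hz =>
        h z (hz.trans (by rw [hdiv j x, hdiv j y, hy]))⟩)
      (fun i j hij => disjoint_fiberIndices _ (hdisj hij) sdiff_subset sdiff_subset) (hτ (j + 1))
      (Or.inr fun i => card_fiberIndices_fiberCore_diff_le (hκ (j + 1)) (hdiv j) _ (hI i))
  have hlast : ∑ i, |D (I i \ U J i)| ≤ B J + 4 * k * δ :=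
    sum_abs_measureReal_sub_diff_fiberCore_le μ ν (hκ J) (hN J) hI hdisj (hτ J) hδ
  have hBJ : B J ≤ ∑ j ∈ Finset.range (J + 1), B j :=
    Finset.single_le_sum (fun j _ => hB0 j) (Finset.self_mem_range_succ J)
  have hBsum : B 0 + ∑ j ∈ Finset.range J, B (j + 1) = ∑ j ∈ Finset.range (J + 1), B j := by
    rw [Finset.sum_range_succ' B, add_comm]
  calc ∑ i, |D (I i)| ≤ ∑ i, (|D (U 0 i)| + ∑ j ∈ Finset.range J, |D (U (j + 1) i \ U j i)|
      + |D (I i \ U J i)|) := Finset.sum_le_sum fun i _ => hsplit i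
    _ = ∑ i, |D (U 0 i)| + ∑ j ∈ Finset.range J, ∑ i, |D (U (j + 1) i \ U j i)|
      + ∑ i, |D (I i \ U J i)| := by
        rw [Finset.sum_add_distrib, Finset.sum_add_distrib, Finset.sum_comm]
    _ ≤ B 0 + ∑ j ∈ Finset.range J, B (j + 1) + (B J + 4 * k * δ) := by
        gcongr with j _
        exact hstep j
    _ ≤ _ := by linarith

lemma empMeasure_real_apply {n : ℕ} (X : Fin n → ℝ) {A : Set ℝ} (hA : MeasurableSet A) :
    (empMeasure n X).real A = (∑ j, A.indicator 1 (X j)) / n := by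
  rw [empMeasure, measureReal_def, Measure.finsetSum_apply, ENNReal.toReal_sum]
  · rw [Finset.sum_div]
    refine Finset.sum_congr rfl fun j _ => ?_
    by_cases h : X j ∈ A <;> simp [hA, h]
  · intro j _
    have : NeZero n := ⟨j.pos.ne'⟩
    by_cases h : X j ∈ A <;> simp [hA, h, NeZero.ne]

lemma isProbabilityMeasure_empMeasure {n : ℕ} (hn : 0 < n) (X : Fin n → ℝ) :
    IsProbabilityMeasure (empMeasure n X) := by
  constructor
  simp only [empMeasure, Measure.finsetSum_apply, Measure.smul_apply, measure_univ, smul_eq_mul,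
    mul_one, Finset.sum_const, Finset.card_univ, Fintype.card_fin, nsmul_eq_mul]
  exact ENNReal.mul_inv_cancel (by exact_mod_cast hn.ne') (ENNReal.natCast_ne_top n)

/-- The fourth moment of the discrepancy of an empirical measure on a fixed set. -/
lemma integral_empMeasure_sub_pow_four_le (P : Measure ℝ) [IsProbabilityMeasure P] {n : ℕ}
    (hn : 0 < n) {A : Set ℝ} (hA : MeasurableSet A) :
    Integrable (fun X => ((empMeasure n X).real A - P.real A) ^ 4)
        (Measure.pi fun _ : Fin n => P) ∧
      ∫ X, ((empMeasure n X).real A - P.real A) ^ 4 ∂(Measure.pi fun _ : Fin n => P) ≤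
        3 * P.real A ^ 2 / n ^ 2 + P.real A / n ^ 3 := by
  set p := P.real A with hp
  have hp0 : 0 ≤ p := measureReal_nonneg
  have hp1 : p ≤ 1 := measureReal_le_one
  set g : ℝ → ℝ := fun x => A.indicator 1 x - p with hg
  have hgm : Measurable g := (measurable_one.indicator hA).sub_const p
  have hgb : ∀ x, |g x| ≤ 1 := fun x => by
    by_cases h : x ∈ A <;> simp only [hg, h, indicator_of_mem, indicator_of_notMem,
      not_false_eq_true, Pi.one_apply] <;> rw [abs_le] <;> constructor <;> linarith
  have hind1 : ∫ x, A.indicator (1 : ℝ → ℝ) x ∂P = p := by rw [integral_indicator_one hA]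
  have hindi : Integrable (A.indicator (1 : ℝ → ℝ)) P := by
    refine Integrable.of_bound (measurable_one.indicator hA).aestronglyMeasurable 1
      (Filter.Eventually.of_forall fun x => ?_)
    by_cases h : x ∈ A <;> simp [h]
  have hgmean : ∫ x, g x ∂P = 0 := by
    rw [integral_sub hindi (integrable_const p), hind1]
    simp
  have hgvar : ∫ x, g x ^ 2 ∂P ≤ p := by
    have h : (fun x => g x ^ 2) = fun x => (1 - 2 * p) * A.indicator (1 : ℝ → ℝ) x + p ^ 2 := by
      ext x
      by_cases h : x ∈ A <;> simp [hg, h]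
      ring
    rw [h, integral_add (hindi.const_mul _) (integrable_const _), integral_const_mul, hind1]
    simp only [integral_const, probReal_univ, smul_eq_mul, one_mul]
    nlinarith
  have hcomp : ∀ (φ : ℝ → ℝ) (_ : Measurable φ) (j : Fin n),
      ∫ X, φ (X j) ∂(Measure.pi fun _ : Fin n => P) = ∫ x, φ x ∂P := fun φ hφ j =>
    integral_comp_eval hφ.aestronglyMeasurable
  obtain ⟨-, -, h4⟩ := moments_sum_of_iIndepFun
    (μ := Measure.pi fun _ : Fin n => P) (Y := fun j X => g (X j)) (v := p)
    (ProbabilityTheory.iIndepFun_pi (X := fun _ => g) fun _ => hgm.aemeasurable)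
    (fun j => hgm.comp (measurable_pi_apply j)) (fun j X => hgb (X j))
    (fun j => (hcomp g hgm j).trans hgmean)
    (fun j => (hcomp (fun x => g x ^ 2) (hgm.pow_const 2) j).trans_le hgvar) Finset.univ
  have hn' : (0 : ℝ) < n := by exact_mod_cast hn
  have hD : (fun X : Fin n → ℝ => ((empMeasure n X).real A - p) ^ 4)
      = fun X => (∑ j, g (X j)) ^ 4 * (1 / (n : ℝ) ^ 4) := by
    ext X
    rw [empMeasure_real_apply X hA]
    simp only [hg, Finset.sum_sub_distrib, Finset.sum_const, Finset.card_univ, Fintype.card_fin,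
      nsmul_eq_mul]
    field_simp
  constructor
  · have hsum : Measurable fun X : Fin n → ℝ => ∑ j, g (X j) :=
      Finset.measurable_sum _ fun j _ => hgm.comp (measurable_pi_apply j)
    rw [hD]
    refine Integrable.mul_const (Integrable.of_bound (hsum.pow_const 4).aestronglyMeasurable
      ((n : ℝ) ^ 4) (Filter.Eventually.of_forall fun X => ?_)) _
    rw [Real.norm_eq_abs, abs_pow]
    gcongr
    refine (Finset.abs_sum_le_sum_abs _ _).trans ?_
    simpa using Finset.sum_le_sum fun j (_ : j ∈ Finset.univ) => hgb (X j)
  · rw [hD, integral_mul_const]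
    refine (mul_le_mul_of_nonneg_right h4 (by positivity)).trans (le_of_eq ?_)
    simp only [Finset.card_univ, Fintype.card_fin]
    field_simp

lemma densityMeasure_real_apply {I : Set ℝ} {f : ℝ → ℝ}
    (hf : IsPDFOn f I) {A : Set ℝ} (hA : MeasurableSet A) (hAI : A ⊆ I) :
    (densityMeasure I f).real A = ∫ x in A, f x := by
  have hnn : 0 ≤ᵐ[volume.restrict A] f :=
    (ae_restrict_mem hA).mono fun x hx => hf.1 x (hAI hx)
  rw [densityMeasure, measureReal_def, withDensity_apply _ hA, Measure.restrict_restrict hA,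
    inter_eq_self_of_subset_left hAI,
    ← ofReal_integral_eq_lintegral_ofReal (hf.2.1.mono_set hAI) hnn,
    ENNReal.toReal_ofReal (integral_nonneg_of_ae hnn)]

lemma isProbabilityMeasure_densityMeasure {I : Set ℝ} {f : ℝ → ℝ} (hI : MeasurableSet I)
    (hf : IsPDFOn f I) : IsProbabilityMeasure (densityMeasure I f) := by
  constructor
  have hnn : 0 ≤ᵐ[volume.restrict I] f := (ae_restrict_mem hI).mono fun x hx => hf.1 x hx
  rw [densityMeasure, withDensity_apply _ MeasurableSet.univ, Measure.restrict_univ,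
    ← ofReal_integral_eq_lintegral_ofReal hf.2.1 hnn, hf.2.2, ENNReal.ofReal_one]

lemma densityMeasure_singleton (I : Set ℝ) (f : ℝ → ℝ) (x : ℝ) :
    densityMeasure I f {x} = 0 :=
  withDensity_absolutelyContinuous _ _ (measure_singleton x)

lemma akDist_nonneg (k : ℕ) (J : Set ℝ) (g : ℝ → ℝ) (μ : Measure ℝ) : 0 ≤ akDist k J g μ := by
  refine Real.sSup_nonneg ?_
  rintro _ ⟨I, -, -, rfl⟩
  positivity

/-- To bound the `A_k`-distance to a density it suffices to bound the discrepancies of the two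
measures on disjoint intervals. -/
lemma akDist_le_of_forall {k : ℕ} {I : Set ℝ} {f : ℝ → ℝ}
    (hf : IsPDFOn f I) {μ : Measure ℝ} {b : ℝ} (hb : 0 ≤ b)
    (h : ∀ K : Fin k → Set ℝ, (∀ i, (K i).OrdConnected) →
      (Pairwise fun i j => Disjoint (K i) (K j)) →
      ∑ i, |μ.real (K i) - (densityMeasure I f).real (K i)| ≤ b) :
    akDist k I f μ ≤ b := by
  refine Real.sSup_le ?_ hb
  rintro _ ⟨K, hK, hdisj, rfl⟩
  refine le_of_eq_of_le (Finset.sum_congr rfl fun i _ => ?_) (h K (fun i => (hK i).2) hdisj)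
  rw [densityMeasure_real_apply hf (hK i).2.measurableSet (hK i).1, measureReal_def]

lemma akDist_le_two {k : ℕ} {I : Set ℝ} {f : ℝ → ℝ} (hI : MeasurableSet I)
    (hf : IsPDFOn f I) (μ : Measure ℝ) [IsProbabilityMeasure μ] : akDist k I f μ ≤ 2 := by
  have := isProbabilityMeasure_densityMeasure hI hf
  refine akDist_le_of_forall hf zero_le_two fun K hK hdisj => ?_
  have hmass : ∀ ρ : Measure ℝ, IsProbabilityMeasure ρ → ∑ i, ρ.real (K i) ≤ 1 := fun ρ _ => by
    rw [← measureReal_iUnion_fintype hdisj fun i => (hK i).measurableSet]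
    exact measureReal_le_one
  calc ∑ i, |μ.real (K i) - (densityMeasure I f).real (K i)|
      ≤ ∑ i, (μ.real (K i) + (densityMeasure I f).real (K i)) :=
        Finset.sum_le_sum fun i _ => by
          rw [abs_le]
          constructor <;> linarith [measureReal_nonneg (μ := μ) (s := K i),
            measureReal_nonneg (μ := densityMeasure I f) (s := K i)]
    _ ≤ 2 := by
        rw [Finset.sum_add_distrib]
        linarith [hmass μ inferInstance, hmass (densityMeasure I f) inferInstance]

/-- The index of the cell of `x` in the partition of the line into quantile cells, each of mass
`1 / N`. -/
noncomputable def quantileCell (P : Measure ℝ) (N : ℕ) (x : ℝ) : ℕ := ⌊(N : ℝ) * P.real (Iic x)⌋₊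

lemma quantileCell_eq_div_two (P : Measure ℝ) (N : ℕ) (x : ℝ) :
    quantileCell P N x = quantileCell P (N * 2) x / 2 := by
  rw [quantileCell, quantileCell, ← Nat.floor_div_ofNat]
  congr 1
  push_cast
  ring

section quantileCell

variable {P : Measure ℝ} [IsProbabilityMeasure P]

lemma monotone_quantileCell (N : ℕ) : Monotone (quantileCell P N) := fun _ _ h =>
  Nat.floor_mono (mul_le_mul_of_nonneg_left (measureReal_mono (Iic_subset_Iic.2 h))
    (Nat.cast_nonneg N))

lemma quantileCell_le (N : ℕ) (x : ℝ) : quantileCell P N x ≤ N :=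
  Nat.floor_le_of_le (mul_le_of_le_one_right (Nat.cast_nonneg N) measureReal_le_one)

lemma measureReal_quantileCell_preimage_le (hP : ∀ x, P {x} = 0) {N : ℕ} (hN : 0 < N) (q : ℕ) :
    P.real (quantileCell P N ⁻¹' {q}) ≤ 1 / N := by
  have hN' : (0 : ℝ) < N := by exact_mod_cast hN
  have h := measureReal_cdf_preimage_Icc_le (P := P) hP
    (a := q / N) (b := (q + 1) / N) (by gcongr; linarith)
  rw [← sub_div, add_sub_cancel_left] at h
  refine (measureReal_mono fun x hx => ?_).trans h
  have hx' : ⌊(N : ℝ) * P.real (Iic x)⌋₊ = q := hx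
  rw [Nat.floor_eq_iff (by positivity)] at hx'
  exact ⟨(div_le_iff₀' hN').2 hx'.1, (le_div_iff₀' hN').2 hx'.2.le⟩

end quantileCell

lemma sum_range_pow_le {x : ℝ} (h0 : 0 ≤ x) (h1 : x < 1) (m : ℕ) :
    ∑ j ∈ Finset.range m, x ^ j ≤ (1 - x)⁻¹ := by
  rw [← tsum_geometric_of_lt_one h0 h1]
  exact (summable_geometric_of_lt_one h0 h1).sum_le_tsum _ fun j _ => by positivity

/-- The expected fourth powers of the discrepancies of a partition into small cells. -/
lemma integral_sum_empMeasure_sub_pow_four_le (P : Measure ℝ) [IsProbabilityMeasure P] {n N : ℕ}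
    (hn : 0 < n) (hN : 0 < N) (hNn : N ≤ 2 * n) {κ : ℝ → ℕ} (hκ : Measurable κ)
    (hmass : ∀ q, P.real (κ ⁻¹' {q}) ≤ 1 / N) :
    ∫ X, ∑ q ∈ Finset.range (N + 1), ((empMeasure n X).real (κ ⁻¹' {q}) - P.real (κ ⁻¹' {q})) ^ 4
      ∂(Measure.pi fun _ : Fin n => P) ≤ 10 / (N * n ^ 2) := by
  have hn' : (0 : ℝ) < n := by exact_mod_cast hn
  have hN1 : (1 : ℝ) ≤ N := by exact_mod_cast hN
  have hN' : (0 : ℝ) < N := by linarith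
  have hNn' : (N : ℝ) ≤ 2 * n := by exact_mod_cast hNn
  have hms : ∀ q, MeasurableSet (κ ⁻¹' {q}) := fun q => hκ (measurableSet_singleton q)
  rw [integral_finsetSum _ fun q _ => (integral_empMeasure_sub_pow_four_le P hn (hms q)).1]
  have hterm : ∀ q, ∫ X, ((empMeasure n X).real (κ ⁻¹' {q}) - P.real (κ ⁻¹' {q})) ^ 4
      ∂(Measure.pi fun _ : Fin n => P) ≤ 5 / (N ^ 2 * n ^ 2) := fun q => by
    refine (integral_empMeasure_sub_pow_four_le P hn (hms q)).2.trans ?_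
    have hq := hmass q
    calc 3 * P.real (κ ⁻¹' {q}) ^ 2 / n ^ 2 + P.real (κ ⁻¹' {q}) / n ^ 3
        ≤ 3 * (1 / (N : ℝ)) ^ 2 / (n : ℝ) ^ 2 + (1 / (N : ℝ)) / (n : ℝ) ^ 3 := by gcongr
      _ = (3 * (n : ℝ) + N) / ((N : ℝ) ^ 2 * (n : ℝ) ^ 3) := by field_simp
      _ ≤ (3 * (n : ℝ) + 2 * n) / ((N : ℝ) ^ 2 * (n : ℝ) ^ 3) := by gcongr
      _ = 5 / ((N : ℝ) ^ 2 * (n : ℝ) ^ 2) := by field_simp; norm_num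
  calc _ ≤ ∑ q ∈ Finset.range (N + 1), 5 / ((N : ℝ) ^ 2 * n ^ 2) :=
        Finset.sum_le_sum fun q _ => hterm q
    _ = (N + 1) * (5 / ((N : ℝ) ^ 2 * n ^ 2)) := by simp
    _ ≤ (2 * N) * (5 / ((N : ℝ) ^ 2 * n ^ 2)) := by gcongr; linarith
    _ = 10 / (N * n ^ 2) := by field_simp; norm_num

/-- A dyadic refinement of a partition into `k` cells reaches a number of cells of order `n`. -/
lemma exists_le_mul_two_pow {k n : ℕ} (hk : 0 < k) (hkn : k ≤ n) :
    ∃ J, n ≤ k * 2 ^ J ∧ ∀ j ≤ J, k * 2 ^ j ≤ 2 * n := by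
  classical
  have hex : ∃ J, n ≤ k * 2 ^ J :=
    ⟨n, Nat.lt_two_pow_self.le.trans (Nat.le_mul_of_pos_left _ hk)⟩
  refine ⟨Nat.find hex, Nat.find_spec hex, fun j hj => ?_⟩
  rcases j with _ | j
  · omega
  · have := Nat.find_min hex (Nat.lt_of_succ_le hj)
    rw [pow_succ, ← mul_assoc]
    omega

lemma integral_akDist_empMeasure_le {I : Set ℝ} {f : ℝ → ℝ} {k n : ℕ} (hI : MeasurableSet I)
    (hf : IsPDFOn f I) (hk : 0 < k) (hn : 0 < n) (hkn : k ≤ n) :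
    ∫ X, akDist k I f (empMeasure n X) ∂(Measure.pi fun _ : Fin n => densityMeasure I f) ≤
      124 * √((k : ℝ) / n) := by
  have hprob := isProbabilityMeasure_densityMeasure hI hf
  have hatom := densityMeasure_singleton I f
  set P := densityMeasure I f with hPdef
  obtain ⟨J, hJn, hJ⟩ := exists_le_mul_two_pow hk hkn
  have hk' : (0 : ℝ) < k := by exact_mod_cast hk
  have hn' : (0 : ℝ) < n := by exact_mod_cast hn
  have hkn' : (k : ℝ) ≤ n := by exact_mod_cast hkn
  set r : ℝ := √(k * n) with hr
  have hr0 : 0 < r := Real.sqrt_pos.2 (by positivity)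
  have hr2 : r ^ 2 = k * n := Real.sq_sqrt (by positivity)
  have hs : √((k : ℝ) / n) = r / n := by
    rw [hr, show (k : ℝ) / n = k * n / n ^ 2 by field_simp, Real.sqrt_div (by positivity),
      Real.sqrt_sq hn'.le]
  set τ : ℕ → ℝ := fun j => (9 / 10) ^ j / r with hτdef
  have hτ : ∀ j, 0 < τ j := fun j => by positivity
  have hNpos : ∀ j, 0 < k * 2 ^ j := fun j => by positivity
  set κ : ℕ → ℝ → ℕ := fun j => quantileCell P (k * 2 ^ j) with hκ
  have hmass : ∀ j q, P.real (κ j ⁻¹' {q}) ≤ 1 / (k * 2 ^ j : ℕ) := fun j q =>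
    measureReal_quantileCell_preimage_le hatom (hNpos j) q
  have hκm : ∀ j, Measurable (κ j) := fun j => (monotone_quantileCell _).measurable
  set W : ℕ → (Fin n → ℝ) → ℝ := fun j X => ∑ q ∈ Finset.range (k * 2 ^ j + 1),
    ((empMeasure n X).real (κ j ⁻¹' {q}) - P.real (κ j ⁻¹' {q})) ^ 4 with hW
  have hWint : ∀ j, Integrable (W j) (Measure.pi fun _ : Fin n => P) := fun j =>
    integrable_finsetSum _ fun q _ => (integral_empMeasure_sub_pow_four_le P hn
      (hκm j (measurableSet_singleton q))).1
  have hBint : ∀ j, Integrable (fun X => 2 * k * τ j + W j X / τ j ^ 3)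
      (Measure.pi fun _ : Fin n => P) := fun j =>
    (integrable_const _).add ((hWint j).div_const _)
  set G : (Fin n → ℝ) → ℝ := fun X =>
    2 * ∑ j ∈ Finset.range (J + 1), (2 * k * τ j + W j X / τ j ^ 3)
      + 4 * k * (1 / (k * 2 ^ J : ℕ)) with hG
  have hSint : Integrable (fun X => 2 * ∑ j ∈ Finset.range (J + 1),
      (2 * k * τ j + W j X / τ j ^ 3)) (Measure.pi fun _ : Fin n => P) :=
    (integrable_finsetSum _ fun j _ => hBint j).const_mul 2
  have hGint : Integrable G (Measure.pi fun _ : Fin n => P) := hSint.add (integrable_const _)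
  have hle : ∀ X, akDist k I f (empMeasure n X) ≤ G X := fun X => by
    have := isProbabilityMeasure_empMeasure hn X
    refine akDist_le_of_forall hf ?_ fun K hK hdisj =>
      sum_abs_measureReal_sub_le (empMeasure n X) P (κ := κ) (N := fun j => k * 2 ^ j)
        (fun j => monotone_quantileCell _) (fun j x => quantileCell_le _ x)
        (fun j x => by simp only [hκ, pow_succ, ← mul_assoc]; exact quantileCell_eq_div_two _ _ x)
        (by simp only [pow_zero, mul_one]; omega) hK hdisj hτ J (hmass J)
    have : ∀ j, 0 ≤ W j X := fun j => Finset.sum_nonneg fun q _ => by positivity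
    have : ∀ j, 0 ≤ 2 * k * τ j + W j X / τ j ^ 3 := fun j => by
      have := this j
      have := hτ j
      positivity
    have := Finset.sum_nonneg fun j (_ : j ∈ Finset.range (J + 1)) => this j
    positivity
  have hBle : ∀ j ∈ Finset.range (J + 1), ∫ X, (2 * k * τ j + W j X / τ j ^ 3)
      ∂(Measure.pi fun _ : Fin n => P) ≤ r / n * (2 * (9 / 10) ^ j + 10 * (500 / 729) ^ j) := by
    intro j hj
    have hWle : ∫ X, W j X ∂(Measure.pi fun _ : Fin n => P) ≤ 10 / ((k * 2 ^ j : ℕ) * n ^ 2) :=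
      integral_sum_empMeasure_sub_pow_four_le P hn (hNpos j)
        (hJ j (Nat.lt_succ_iff.1 (Finset.mem_range.1 hj))) (hκm j) (hmass j)
    rw [integral_add (integrable_const _) ((hWint j).div_const _), integral_div]
    simp only [integral_const, probReal_univ, smul_eq_mul, one_mul]
    have hfirst : 2 * k * τ j = r / n * (2 * (9 / 10) ^ j) := by
      simp only [hτdef]
      field_simp
      rw [hr2]
    have hsecond : 10 / ((k * 2 ^ j : ℕ) * (n : ℝ) ^ 2) / τ j ^ 3
        = r / n * (10 * (500 / 729) ^ j) := by
      have h500 : (500 / 729 : ℝ) ^ j = 1 / (2 ^ j * ((9 / 10) ^ j) ^ 3) := by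
        rw [← pow_mul, mul_comm j 3, pow_mul, ← mul_pow, ← one_div_pow]
        norm_num
      have h9 : (0 : ℝ) < (9 / 10) ^ j := by positivity
      rw [h500]
      simp only [hτdef]
      generalize ((9 : ℝ) / 10) ^ j = t at h9 ⊢
      push_cast
      have hr3 : r ^ 3 = k * n * r := by rw [pow_succ, hr2]
      rw [div_pow, hr3]
      field_simp
    rw [hfirst, mul_add, ← hsecond]
    have := hτ j
    gcongr
  have hlast : 4 * k * (1 / (k * 2 ^ J : ℕ)) ≤ 4 * (r / n) := by
    have h1 : (n : ℝ) ≤ (k * 2 ^ J : ℕ) := by exact_mod_cast hJn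
    have h2 : (k : ℝ) ≤ r := Real.le_sqrt_of_sq_le (by nlinarith)
    calc 4 * k * (1 / ((k * 2 ^ J : ℕ) : ℝ)) ≤ 4 * r * (1 / n) := by gcongr
      _ = 4 * (r / n) := by ring
  calc ∫ X, akDist k I f (empMeasure n X) ∂(Measure.pi fun _ : Fin n => P)
      ≤ ∫ X, G X ∂(Measure.pi fun _ : Fin n => P) :=
        integral_mono_of_nonneg (Filter.Eventually.of_forall fun X => akDist_nonneg _ _ _ _) hGint
          (Filter.Eventually.of_forall hle)
    _ = 2 * ∑ j ∈ Finset.range (J + 1), ∫ X, (2 * k * τ j + W j X / τ j ^ 3)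
          ∂(Measure.pi fun _ : Fin n => P) + 4 * k * (1 / (k * 2 ^ J : ℕ)) := by
        rw [integral_add hSint (integrable_const _), integral_const_mul,
          integral_finsetSum _ fun j _ => hBint j]
        simp
    _ ≤ 2 * ∑ j ∈ Finset.range (J + 1), r / n * (2 * (9 / 10) ^ j + 10 * (500 / 729) ^ j)
          + 4 * (r / n) := by
        gcongr with j hj
        exact hBle j hj
    _ = r / n * (4 * ∑ j ∈ Finset.range (J + 1), (9 / 10) ^ j
          + 20 * ∑ j ∈ Finset.range (J + 1), (500 / 729) ^ j + 4) := by
        rw [← Finset.mul_sum, Finset.sum_add_distrib, ← Finset.mul_sum, ← Finset.mul_sum]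
        ring
    _ ≤ r / n * (4 * (1 - 9 / 10)⁻¹ + 20 * (1 - 500 / 729)⁻¹ + 4) := by
        gcongr
        · exact sum_range_pow_le (by norm_num) (by norm_num) _
        · exact sum_range_pow_le (by norm_num) (by norm_num) _
    _ ≤ r / n * 124 := by
        gcongr
        norm_num
    _ = 124 * √((k : ℝ) / n) := by rw [hs, mul_comm]

/-- (VC inequality for the `A_k`-norm) There is a universal constant `C > 0` such that for
every pdf `f` on an interval `I` and all positive integers `k` and `n`: if `X₁, …, X_n` are
drawn i.i.d. from the distribution with density `f` and `μ_n` is the empirical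
distribution, then `E[‖μ_n − f‖_{A_k}] ≤ C·√(k/n)`. -/
theorem stmt16 : ∃ C : ℝ, 0 < C ∧
    ∀ (I : Set ℝ) (f : ℝ → ℝ) (k n : ℕ),
      I.OrdConnected → MeasurableSet I → IsPDFOn f I → 0 < k → 0 < n →
      (∫ X, akDist k I f (empMeasure n X)
          ∂(Measure.pi fun _ : Fin n => densityMeasure I f)) ≤
        C * Real.sqrt ((k : ℝ) / (n : ℝ)) := by
  refine ⟨124, by norm_num, fun I f k n _ hI hf hk hn => ?_⟩
  rcases le_or_gt k n with hkn | hkn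
  · exact integral_akDist_empMeasure_le hI hf hk hn hkn
  have hprob := isProbabilityMeasure_densityMeasure hI hf
  have hn' : (0 : ℝ) < n := by exact_mod_cast hn
  have hs : 1 ≤ √((k : ℝ) / n) := Real.one_le_sqrt.2 <| by
    rw [one_le_div hn']
    exact_mod_cast hkn.le
  calc ∫ X, akDist k I f (empMeasure n X) ∂(Measure.pi fun _ : Fin n => densityMeasure I f)
      ≤ ∫ _, 2 ∂(Measure.pi fun _ : Fin n => densityMeasure I f) :=
        integral_mono_of_nonneg (Filter.Eventually.of_forall fun X => akDist_nonneg _ _ _ _)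
          (integrable_const _) (Filter.Eventually.of_forall fun X => by
            have := isProbabilityMeasure_empMeasure hn X
            exact akDist_le_two hI hf (empMeasure n X))
    _ = 2 := by simp
    _ ≤ 124 * √((k : ℝ) / n) := by linarith
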